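/- The randomized median-peaks mechanism (output x_m - b and x_m + b each with probability 1/2, x_m the median) is truthful-in-expectation: for every profile x, every agent i, and every misreport x'ᵢ, the expected cost of agent i under the mechanism run on (x'ᵢ, x₋ᵢ) is at least her expected cost under the mechanism run on x. -/

import Mathlib

noncomputable def cost (b c y x : ℝ) : ℝ := c + min |x - b - y| |x + b - y|

/-- The median report: the `⌈n/2⌉`-th smallest value of the profile. -/
noncomputable def med (n : ℕ) (x : Fin n → ℝ) : ℝ :=
  ((List.ofFn x).insertionSort (· ≤ ·)).getD ((n + 1) / 2 - 1) 0

theorem sorted_getD_le_iff (t : ℝ) (l : List ℝ) (h : l.Pairwise (· ≤ ·)) :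
    ∀ j, j < l.length → (l.getD j 0 ≤ t ↔ j < l.countP (fun a => decide (a ≤ t))) := by
  induction l with
  | nil => intro j hj; simp at hj
  | cons a l ih =>
    intro j hj
    rw [List.pairwise_cons] at h
    by_cases hat : a ≤ t
    · rw [List.countP_cons_of_pos (by simpa using hat)]
      cases j with
      | zero => simp [hat]
      | succ j =>
        have := ih h.2 j (by simpa using hj)
        rw [List.getD_cons_succ, this]
        omega
    · have h0 : (a :: l).countP (fun a => decide (a ≤ t)) = 0 := by
        rw [List.countP_eq_zero]
        intro y hy
        rcases List.mem_cons.1 hy with rfl | hy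
        · simpa using hat
        · have := h.1 y hy
          simp only [decide_eq_true_eq]
          intro hh
          exact hat (this.trans hh)
      rw [h0]
      rw [List.countP_eq_zero] at h0
      have hm : (a :: l).getD j 0 ∈ a :: l := by
        rw [List.getD_eq_getElem _ _ hj]
        exact List.getElem_mem hj
      have := h0 _ hm
      simp only [decide_eq_true_eq] at this
      simp only [this, Nat.not_lt_zero]

theorem med_le_iff (n : ℕ) (hn : 0 < n) (x : Fin n → ℝ) (t : ℝ) :
    med n x ≤ t ↔ (n + 1) / 2 - 1 < (List.finRange n).countP (fun j => decide (x j ≤ t)) := by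
  unfold med
  rw [sorted_getD_le_iff t _ (List.pairwise_insertionSort _ _) _ (by simp; omega),
    (List.perm_insertionSort _ _).countP_eq, List.ofFn_eq_map, List.countP_map]
  rfl

theorem med_le_of_imp (n : ℕ) (hn : 0 < n) (x y : Fin n → ℝ) (t : ℝ)
    (h : ∀ j, x j ≤ t → y j ≤ t) (hx : med n x ≤ t) : med n y ≤ t := by
  rw [med_le_iff n hn] at *
  refine hx.trans_le (List.countP_mono_left ?_)
  intro j _ hj
  simp only [decide_eq_true_eq] at *
  exact h j hj

theorem stmt_10 (b c : ℝ) (hb : 0 < b) (hc : 0 < c) (n : ℕ)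
    (x : Fin n → ℝ) (i : Fin n) (x' : ℝ) :
    (1 / 2) * cost b c (med n x - b) (x i) + (1 / 2) * cost b c (med n x + b) (x i)
      ≤ (1 / 2) * cost b c (med n (Function.update x i x') - b) (x i)
        + (1 / 2) * cost b c (med n (Function.update x i x') + b) (x i) := by
  have hn : 0 < n := i.pos
  have h1 : x i < med n x → med n x ≤ med n (Function.update x i x') := by
    intro h
    by_contra hlt
    push Not at hlt
    have := med_le_of_imp n hn (Function.update x i x') x
      (max (x i) (med n (Function.update x i x'))) (by
        intro j hj
        by_cases hji : j = i
        · subst hji; exact le_max_left _ _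
        · rwa [Function.update_of_ne hji] at hj) (le_max_right _ _)
    exact absurd this (not_le.2 (max_lt h hlt))
  have h2 : med n x < x i → med n (Function.update x i x') ≤ med n x := by
    intro h
    refine med_le_of_imp n hn x _ _ ?_ le_rfl
    intro j hj
    by_cases hji : j = i
    · subst hji; exact absurd hj (not_le.2 h)
    · rwa [Function.update_of_ne hji]
  generalize med n (Function.update x i x') = m' at *
  generalize med n x = m at *
  generalize x i = a at *
  have e1 : ∀ m, a - b - (m - b) = a - m := fun m => by ring
  have e2 : ∀ m, a + b - (m - b) = a - m + 2 * b := fun m => by ring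
  have e3 : ∀ m, a - b - (m + b) = a - m - 2 * b := fun m => by ring
  have e4 : ∀ m, a + b - (m + b) = a - m := fun m => by ring
  unfold cost
  simp only [e1, e2, e3, e4]
  have key : ∀ d e : ℝ, 0 ≤ d → d ≤ e →
      min |d| |d + 2 * b| + min |d - 2 * b| |d| ≤ min |e| |e + 2 * b| + min |e - 2 * b| |e| := by
    intro d e hd hde
    rw [abs_of_nonneg hd, abs_of_nonneg (hd.trans hde), abs_of_nonneg (by linarith : 0 ≤ d + 2 * b),
      abs_of_nonneg (by linarith : 0 ≤ e + 2 * b), min_eq_left (by linarith : d ≤ d + 2 * b),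
      min_eq_left (by linarith : e ≤ e + 2 * b)]
    rcases min_cases |d - 2 * b| d with h | h <;> rcases min_cases |e - 2 * b| e with h' | h' <;>
    rcases abs_cases (d - 2 * b) with h3 | h3 <;> rcases abs_cases (e - 2 * b) with h4 | h4 <;>
    linarith
  have even : ∀ d : ℝ, min |-d| |-d + 2 * b| + min |-d - 2 * b| |-d|
      = min |d| |d + 2 * b| + min |d - 2 * b| |d| := by
    intro d
    rw [abs_neg, show -d + 2 * b = -(d - 2 * b) by ring, show -d - 2 * b = -(d + 2 * b) by ring,
      abs_neg, abs_neg, min_comm |d + 2 * b|, min_comm |d - 2 * b|, add_comm]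
  rcases lt_trichotomy a m with h | h | h
  · have hk := key (-(a - m)) (-(a - m')) (by linarith) (by linarith [h1 h])
    rw [even, even] at hk
    linarith
  · have e0 : a - m = 0 := by linarith
    have p1 : min |a - m| |a - m + 2 * b| ≤ 0 := (min_le_left _ _).trans (by simp [e0])
    have p2 : min |a - m - 2 * b| |a - m| ≤ 0 := (min_le_right _ _).trans (by simp [e0])
    have p3 : 0 ≤ min |a - m'| |a - m' + 2 * b| := by positivity
    have p4 : 0 ≤ min |a - m' - 2 * b| |a - m'| := by positivity
    linarith
  · have hk := key (a - m) (a - m') (by linarith) (by linarith [h2 h])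
    linarith
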